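/- Let q ∈ ℂ with q ≠ 0 and let A = A(Gr_θ(2;4)). Then: (i) the image of Λ¹² is a normal element, i.e. Λ¹²·A = A·Λ¹² as subsets of A, so its non-negative powers form a left (and right) denominator (Ore) set; (ii) in the left Ore localization of A at the powers of Λ¹², the elements ζ₁ = −(Λ¹²)⁻¹Λ¹⁴, ζ₂ = −(Λ¹²)⁻¹Λ²⁴, ζ̄₁ = (Λ¹²)⁻¹Λ²³, ζ̄₂ = (Λ¹²)⁻¹Λ¹³ satisfy the relations ζ₁ζ̄₁ = q⁻²ζ̄₁ζ₁, ζ₂ζ̄₂ = q²ζ̄₂ζ₂, ζ₁ζ₂ = q⁻²ζ₂ζ₁, ζ̄₁ζ̄₂ = q²ζ̄₂ζ̄₁, ζ₁ζ̄₂ = ζ̄₂ζ₁, ζ₂ζ̄₁ = ζ̄₁ζ₂, and moreover q·(Λ¹²)⁻¹Λ³⁴ = ζ̄₁ζ₁ − ζ₂ζ̄₂; (iii) the unital ℂ-subalgebra generated by ζ₁, ζ₂, ζ̄₁, ζ̄₂ is isomorphic, via the map sending generators to generators, to the quotient of the free ℂ-algebra on x₁, x₂, y₁, y₂ by the ideal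 generated by x₁y₁ − q⁻²y₁x₁, x₂y₂ − q²y₂x₂, x₁x₂ − q⁻²x₂x₁, y₁y₂ − q²y₂y₁, x₁y₂ − y₂x₁, x₂y₁ − y₁x₂. -/

import Mathlib

noncomputable section

open FreeAlgebra

/-- The relations of the homogeneous coordinate algebra `A(Gr_θ(2;4))` of the
noncommutative Klein quadric, on six generators indexed by `0 ↦ Λ¹², 1 ↦ Λ¹³, 2 ↦ Λ¹⁴,
3 ↦ Λ²³, 4 ↦ Λ²⁴, 5 ↦ Λ³⁴`. -/
inductive GrRel (q : ℂ) : FreeAlgebra ℂ (Fin 6) → FreeAlgebra ℂ (Fin 6) → Prop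
  | r12_13 : GrRel q (ι ℂ 0 * ι ℂ 1) ((q ^ 2)⁻¹ • (ι ℂ 1 * ι ℂ 0))
  | r12_14 : GrRel q (ι ℂ 0 * ι ℂ 2) ((q ^ 2)⁻¹ • (ι ℂ 2 * ι ℂ 0))
  | r12_23 : GrRel q (ι ℂ 0 * ι ℂ 3) (q ^ 2 • (ι ℂ 3 * ι ℂ 0))
  | r12_24 : GrRel q (ι ℂ 0 * ι ℂ 4) (q ^ 2 • (ι ℂ 4 * ι ℂ 0))
  | r13_23 : GrRel q (ι ℂ 1 * ι ℂ 3) (q ^ 2 • (ι ℂ 3 * ι ℂ 1))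
  | r13_24 : GrRel q (ι ℂ 1 * ι ℂ 4) (q ^ 2 • (ι ℂ 4 * ι ℂ 1))
  | r14_23 : GrRel q (ι ℂ 2 * ι ℂ 3) (q ^ 2 • (ι ℂ 3 * ι ℂ 2))
  | r14_24 : GrRel q (ι ℂ 2 * ι ℂ 4) (q ^ 2 • (ι ℂ 4 * ι ℂ 2))
  | central34 (i : Fin 6) : GrRel q (ι ℂ 5 * ι ℂ i) (ι ℂ i * ι ℂ 5)
  | r13_14 : GrRel q (ι ℂ 1 * ι ℂ 2) (ι ℂ 2 * ι ℂ 1)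
  | r23_24 : GrRel q (ι ℂ 3 * ι ℂ 4) (ι ℂ 4 * ι ℂ 3)
  | pluecker : GrRel q (ι ℂ 0 * ι ℂ 5) (q⁻¹ • (ι ℂ 1 * ι ℂ 4) - q • (ι ℂ 3 * ι ℂ 2))

/-- The homogeneous coordinate algebra `A = A(Gr_θ(2;4))`. -/
abbrev GrAlg (q : ℂ) := RingQuot (GrRel q)

/-- The images of the minors: `Λm q 0 = Λ¹², Λm q 1 = Λ¹³, Λm q 2 = Λ¹⁴, Λm q 3 = Λ²³,
`Λm q 4 = Λ²⁴`, `Λm q 5 = Λ³⁴`. -/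
def Λm (q : ℂ) (i : Fin 6) : GrAlg q := RingQuot.mkAlgHom ℂ (GrRel q) (ι ℂ i)

/-- The relations presenting the coordinate algebra `A(ℝ̃⁴_θ)` of the second affine
chart of the noncommutative four-sphere, on generators `0 ↦ x₁, 1 ↦ x₂, 2 ↦ y₁,
3 ↦ y₂`. -/
inductive R4tRel (q : ℂ) : FreeAlgebra ℂ (Fin 4) → FreeAlgebra ℂ (Fin 4) → Prop
  | x1y1 : R4tRel q (ι ℂ 0 * ι ℂ 2) ((q ^ 2)⁻¹ • (ι ℂ 2 * ι ℂ 0))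
  | x2y2 : R4tRel q (ι ℂ 1 * ι ℂ 3) (q ^ 2 • (ι ℂ 3 * ι ℂ 1))
  | x1x2 : R4tRel q (ι ℂ 0 * ι ℂ 1) ((q ^ 2)⁻¹ • (ι ℂ 1 * ι ℂ 0))
  | y1y2 : R4tRel q (ι ℂ 2 * ι ℂ 3) (q ^ 2 • (ι ℂ 3 * ι ℂ 2))
  | x1y2 : R4tRel q (ι ℂ 0 * ι ℂ 3) (ι ℂ 3 * ι ℂ 0)
  | x2y1 : R4tRel q (ι ℂ 1 * ι ℂ 2) (ι ℂ 2 * ι ℂ 1)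

/-- The coordinate algebra `A(ℝ̃⁴_θ)` presented by generators and relations. -/
abbrev R4tAlg (q : ℂ) := RingQuot (R4tRel q)

/-- The generators of `A(ℝ̃⁴_θ)`. -/
def xg (q : ℂ) (i : Fin 4) : R4tAlg q := RingQuot.mkAlgHom ℂ (R4tRel q) (ι ℂ i)

lemma gr_lift (q : ℂ) {B : Type} [Ring B] [Algebra ℂ B] (f : Fin 6 → B)
    (h01 : f 0 * f 1 = (q ^ 2)⁻¹ • (f 1 * f 0))
    (h02 : f 0 * f 2 = (q ^ 2)⁻¹ • (f 2 * f 0))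
    (h03 : f 0 * f 3 = q ^ 2 • (f 3 * f 0))
    (h04 : f 0 * f 4 = q ^ 2 • (f 4 * f 0))
    (h13 : f 1 * f 3 = q ^ 2 • (f 3 * f 1))
    (h14 : f 1 * f 4 = q ^ 2 • (f 4 * f 1))
    (h23 : f 2 * f 3 = q ^ 2 • (f 3 * f 2))
    (h24 : f 2 * f 4 = q ^ 2 • (f 4 * f 2))
    (h5 : ∀ i, f 5 * f i = f i * f 5)
    (h12 : f 1 * f 2 = f 2 * f 1)
    (h34 : f 3 * f 4 = f 4 * f 3)
    (hp : f 0 * f 5 = q⁻¹ • (f 1 * f 4) - q • (f 3 * f 2)) :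
    ∃ ψ : GrAlg q →ₐ[ℂ] B, ∀ i, ψ (Λm q i) = f i := by
  refine ⟨RingQuot.liftAlgHom ℂ ⟨FreeAlgebra.lift ℂ f, ?_⟩, ?_⟩
  · intro x y h
    cases h <;> simp only [map_mul, map_sub, map_smul, FreeAlgebra.lift_ι_apply] <;>
      first | assumption | exact h5 _
  · intro i
    rw [Λm, RingQuot.liftAlgHom_mkAlgHom_apply, FreeAlgebra.lift_ι_apply]

lemma r4_lift (q : ℂ) {B : Type} [Ring B] [Algebra ℂ B] (f : Fin 4 → B)
    (h02 : f 0 * f 2 = (q ^ 2)⁻¹ • (f 2 * f 0))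
    (h13 : f 1 * f 3 = q ^ 2 • (f 3 * f 1))
    (h01 : f 0 * f 1 = (q ^ 2)⁻¹ • (f 1 * f 0))
    (h23 : f 2 * f 3 = q ^ 2 • (f 3 * f 2))
    (h03 : f 0 * f 3 = f 3 * f 0)
    (h12 : f 1 * f 2 = f 2 * f 1) :
    ∃ ψ : R4tAlg q →ₐ[ℂ] B, ∀ i, ψ (xg q i) = f i := by
  refine ⟨RingQuot.liftAlgHom ℂ ⟨FreeAlgebra.lift ℂ f, ?_⟩, ?_⟩
  · intro x y h
    cases h <;> simp only [map_mul, map_smul, FreeAlgebra.lift_ι_apply] <;> assumption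
  · intro i
    rw [xg, RingQuot.liftAlgHom_mkAlgHom_apply, FreeAlgebra.lift_ι_apply]

lemma gr_ext (q : ℂ) {B : Type} [Ring B] [Algebra ℂ B] {f g : GrAlg q →ₐ[ℂ] B}
    (h : ∀ i, f (Λm q i) = g (Λm q i)) : f = g := by
  apply RingQuot.ringQuot_ext'
  apply FreeAlgebra.hom_ext
  funext i
  exact h i

lemma r4_ext (q : ℂ) {B : Type} [Ring B] [Algebra ℂ B] {f g : R4tAlg q →ₐ[ℂ] B}
    (h : ∀ i, f (xg q i) = g (xg q i)) : f = g := by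
  apply RingQuot.ringQuot_ext'
  apply FreeAlgebra.hom_ext
  funext i
  exact h i

lemma gr_rel (q : ℂ) :
    Λm q 0 * Λm q 1 = (q ^ 2)⁻¹ • (Λm q 1 * Λm q 0) ∧
    Λm q 0 * Λm q 2 = (q ^ 2)⁻¹ • (Λm q 2 * Λm q 0) ∧
    Λm q 0 * Λm q 3 = q ^ 2 • (Λm q 3 * Λm q 0) ∧
    Λm q 0 * Λm q 4 = q ^ 2 • (Λm q 4 * Λm q 0) ∧
    Λm q 1 * Λm q 3 = q ^ 2 • (Λm q 3 * Λm q 1) ∧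
    Λm q 1 * Λm q 4 = q ^ 2 • (Λm q 4 * Λm q 1) ∧
    Λm q 2 * Λm q 3 = q ^ 2 • (Λm q 3 * Λm q 2) ∧
    Λm q 2 * Λm q 4 = q ^ 2 • (Λm q 4 * Λm q 2) ∧
    (∀ i, Λm q 5 * Λm q i = Λm q i * Λm q 5) ∧
    Λm q 1 * Λm q 2 = Λm q 2 * Λm q 1 ∧
    Λm q 3 * Λm q 4 = Λm q 4 * Λm q 3 ∧
    Λm q 0 * Λm q 5 = q⁻¹ • (Λm q 1 * Λm q 4) - q • (Λm q 3 * Λm q 2) := by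
  have key : ∀ {x y}, GrRel q x y → RingQuot.mkAlgHom ℂ (GrRel q) x =
      RingQuot.mkAlgHom ℂ (GrRel q) y := fun h => RingQuot.mkAlgHom_rel ℂ h
  simp only [Λm, ← map_mul, ← map_smul, ← map_sub]
  exact ⟨key .r12_13, key .r12_14, key .r12_23, key .r12_24, key .r13_23, key .r13_24,
    key .r14_23, key .r14_24, fun i => key (.central34 i), key .r13_14, key .r23_24,
    key .pluecker⟩

lemma r4_rel (q : ℂ) :
    xg q 0 * xg q 2 = (q ^ 2)⁻¹ • (xg q 2 * xg q 0) ∧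
    xg q 1 * xg q 3 = q ^ 2 • (xg q 3 * xg q 1) ∧
    xg q 0 * xg q 1 = (q ^ 2)⁻¹ • (xg q 1 * xg q 0) ∧
    xg q 2 * xg q 3 = q ^ 2 • (xg q 3 * xg q 2) ∧
    xg q 0 * xg q 3 = xg q 3 * xg q 0 ∧
    xg q 1 * xg q 2 = xg q 2 * xg q 1 := by
  have key : ∀ {x y}, R4tRel q x y → RingQuot.mkAlgHom ℂ (R4tRel q) x =
      RingQuot.mkAlgHom ℂ (R4tRel q) y := fun h => RingQuot.mkAlgHom_rel ℂ h
  simp only [xg, ← map_mul, ← map_smul]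
  exact ⟨key .x1y1, key .x2y2, key .x1x2, key .y1y2, key .x1y2, key .x2y1⟩

/-- Diagonal rescaling of the Grassmannian algebra. -/
lemma gr_scale (q : ℂ) (t : Fin 6 → ℂ) (h1 : t 0 * t 5 = t 1 * t 4) (h2 : t 0 * t 5 = t 3 * t 2) :
    ∃ σ : GrAlg q →ₐ[ℂ] GrAlg q, ∀ i, σ (Λm q i) = t i • Λm q i := by
  obtain ⟨a, b, c, d, e, f, g, h, k, l, m, n⟩ := gr_rel q
  apply gr_lift q (fun i => t i • Λm q i)
  case hp =>
    simp only [smul_mul_assoc, mul_smul_comm, smul_smul, n, smul_sub]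
    congr 2
    · linear_combination q⁻¹ * h1
    · linear_combination q * h2
  case h5 =>
    intro i
    simp only [smul_mul_assoc, mul_smul_comm, smul_smul, k i, mul_comm]
  all_goals
    simp only [smul_mul_assoc, mul_smul_comm, smul_smul, a, b, c, d, e, f, g, h, l, m]
    congr 1
    ring

lemma r4_scale (q : ℂ) (t : Fin 4 → ℂ) :
    ∃ σ : R4tAlg q →ₐ[ℂ] R4tAlg q, ∀ i, σ (xg q i) = t i • xg q i := by
  obtain ⟨a, b, c, d, e, f⟩ := r4_rel q
  apply r4_lift q (fun i => t i • xg q i)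
  all_goals
    simp only [smul_mul_assoc, mul_smul_comm, smul_smul, a, b, c, d, e, f]
    congr 1
    ring

/-- The normalizing automorphism of `Λ¹²`. -/
lemma gr_normal (q : ℂ) (hq : q ≠ 0) : ∃ σ τ : GrAlg q →ₐ[ℂ] GrAlg q,
    (∀ a, σ (τ a) = a) ∧ (∀ a, τ (σ a) = a) ∧ σ (Λm q 0) = Λm q 0 ∧
    ∀ a, Λm q 0 * a = σ a * Λm q 0 := by
  have hq2 : q ^ 2 ≠ 0 := pow_ne_zero 2 hq
  obtain ⟨σ, hσ⟩ := gr_scale q ![1, (q^2)⁻¹, (q^2)⁻¹, q^2, q^2, 1]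
    (by simp [hq]) (by simp [hq])
  obtain ⟨τ, hτ⟩ := gr_scale q ![1, q^2, q^2, (q^2)⁻¹, (q^2)⁻¹, 1]
    (by simp [hq]) (by simp [hq])
  obtain ⟨a, b, c, d, e, f, g, h, k, l, m, n⟩ := gr_rel q
  refine ⟨σ, τ, ?_, ?_, ?_, ?_⟩
  · have : σ.comp τ = AlgHom.id ℂ _ := by
      apply gr_ext
      intro i
      simp only [AlgHom.comp_apply, hσ, hτ, map_smul, smul_smul, AlgHom.id_apply]
      fin_cases i <;> simp [hq]
    exact fun x => DFunLike.congr_fun this x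
  · have : τ.comp σ = AlgHom.id ℂ _ := by
      apply gr_ext
      intro i
      simp only [AlgHom.comp_apply, hσ, hτ, map_smul, smul_smul, AlgHom.id_apply]
      fin_cases i <;> simp [hq]
    exact fun x => DFunLike.congr_fun this x
  · simp [hσ]
  · intro x
    obtain ⟨y, rfl⟩ := RingQuot.mkAlgHom_surjective ℂ (GrRel q) x
    induction y using FreeAlgebra.induction with
    | grade0 r =>
      rw [AlgHom.commutes, AlgHom.commutes]
      exact (Algebra.commutes r _).symm
    | grade1 i =>
      change Λm q 0 * Λm q i = σ (Λm q i) * Λm q 0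
      rw [hσ, smul_mul_assoc]
      fin_cases i
      · simp
      · exact a
      · exact b
      · exact c
      · exact d
      · simpa using (k 0).symm
    | mul x y hx hy => rw [map_mul, map_mul, ← mul_assoc, hx, mul_assoc, hy, mul_assoc]
    | add x y hx hy => rw [map_add, map_add, mul_add, add_mul, hx, hy]

lemma gr_range (q : ℂ) (hq : q ≠ 0) : Set.range (fun a : GrAlg q => Λm q 0 * a)
        = Set.range (fun a : GrAlg q => a * Λm q 0) := by
  obtain ⟨σ, τ, h1, h2, h3, h4⟩ := gr_normal q hq
  ext x
  constructor
  · rintro ⟨a, rfl⟩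
    exact ⟨σ a, (h4 a).symm⟩
  · rintro ⟨a, rfl⟩
    exact ⟨τ a, by simp only [h4, h1]⟩

lemma gr_ore (q : ℂ) (hq : q ≠ 0) :
    Nonempty (OreLocalization.OreSet (Submonoid.powers (Λm q 0))) := by
  obtain ⟨σ, τ, h1, h2, h3, h4⟩ := gr_normal q hq
  have hn : ∀ (n : ℕ) (a : GrAlg q), Λm q 0 ^ n * a = (σ^[n]) a * Λm q 0 ^ n := by
    intro n
    induction n with
    | zero => intro a; simp
    | succ n ih =>
      intro a
      rw [pow_succ, mul_assoc, h4, ← mul_assoc, ih, Function.iterate_succ_apply, mul_assoc]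
  have hit : ∀ (n : ℕ) (a b : GrAlg q), (σ^[n]) (a * b) = (σ^[n]) a * (σ^[n]) b := by
    intro n
    induction n with
    | zero => intro a b; rfl
    | succ n ih => intro a b; simp only [Function.iterate_succ_apply, map_mul, ih]
  have hx : ∀ (n m : ℕ), (σ^[n]) (Λm q 0 ^ m) = Λm q 0 ^ m := by
    intro n m
    induction n with
    | zero => rfl
    | succ n ih => rw [Function.iterate_succ_apply, map_pow, h3, ih]
  have hore : ∀ (r : GrAlg q) (s : Submonoid.powers (Λm q 0)),
      ∃ r' : GrAlg q, (s : GrAlg q) * r = r' * s := by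
    rintro r ⟨_, n, rfl⟩
    exact ⟨_, hn n r⟩
  choose num hnum using hore
  refine ⟨⟨?_, num, fun _ s => s, hnum⟩⟩
  rintro r₁ r₂ ⟨_, n, rfl⟩ h
  refine ⟨⟨_, n, rfl⟩, ?_⟩
  simp only at h ⊢
  rw [hn, hn]
  have := congrArg (σ^[n]) h
  rwa [hit, hit, hx] at this

section
variable {B : Type} [Ring B] [Algebra ℂ B]

lemma inv_comm_aux {x v a : B} {c : ℂ} (hv : x * v = 1) (hv' : v * x = 1)
    (h : x * a = c • (a * x)) : a * v = c • (v * a) := by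
  calc a * v = v * (x * a) * v := by rw [← mul_assoc, hv', one_mul]
    _ = c • (v * a) := by
      rw [h, mul_smul_comm, smul_mul_assoc, mul_assoc, mul_assoc, hv, mul_one]

lemma prod_aux {v a b : B} {c : ℂ} (h : a * v = c • (v * a)) :
    (v * a) * (v * b) = c • (v * (v * (a * b))) := by
  calc (v * a) * (v * b) = v * (a * v) * b := by simp only [mul_assoc]
    _ = _ := by rw [h]; simp only [mul_assoc, mul_smul_comm, smul_mul_assoc]
end

lemma rep_gen (q : ℂ) (hq : q ≠ 0) {B : Type} [Ring B] [Algebra ℂ B] (S a0 a1 a2 a3 : B)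
    (c0 : S * a0 = (q^2)⁻¹ • (a0 * S)) (c1 : S * a1 = q^2 • (a1 * S))
    (c2 : S * a2 = q^2 • (a2 * S)) (c3 : S * a3 = (q^2)⁻¹ • (a3 * S))
    (r02 : a0 * a2 = (q ^ 2)⁻¹ • (a2 * a0))
    (r13 : a1 * a3 = q ^ 2 • (a3 * a1))
    (r01 : a0 * a1 = (q ^ 2)⁻¹ • (a1 * a0))
    (r23 : a2 * a3 = q ^ 2 • (a3 * a2))
    (r03 : a0 * a3 = a3 * a0)
    (r12 : a1 * a2 = a2 * a1) :
    ∃ ψ : GrAlg q →ₐ[ℂ] B, ψ (Λm q 0) = S ∧ ψ (Λm q 2) = - (S * a0) ∧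
      ψ (Λm q 4) = - (S * a1) ∧ ψ (Λm q 3) = S * a2 ∧ ψ (Λm q 1) = S * a3 := by
  have hq2 : q ^ 2 ≠ 0 := pow_ne_zero 2 hq
  have d0 : a0 * S = q^2 • (S * a0) := by rw [c0, smul_smul, mul_inv_cancel₀ hq2, one_smul]
  have d1 : a1 * S = (q^2)⁻¹ • (S * a1) := by rw [c1, smul_smul, inv_mul_cancel₀ hq2, one_smul]
  have d2 : a2 * S = (q^2)⁻¹ • (S * a2) := by rw [c2, smul_smul, inv_mul_cancel₀ hq2, one_smul]
  have d3 : a3 * S = q^2 • (S * a3) := by rw [c3, smul_smul, mul_inv_cancel₀ hq2, one_smul]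
  -- the quadratic element
  obtain ⟨ρ, hρ⟩ : ∃ ρ, ρ = a2 * a0 - a1 * a3 := ⟨_, rfl⟩
  have dρ : ρ * S = (1:ℂ) • (S * ρ) := by
    rw [hρ, sub_mul, mul_assoc, mul_assoc, d0, d3, mul_smul_comm, mul_smul_comm, ← mul_assoc,
      ← mul_assoc, d2, d1]
    simp only [smul_mul_assoc, smul_smul, mul_inv_cancel₀ hq2, mul_sub, mul_assoc, one_smul]
  have e0 : a0 * ρ = (q^2)⁻¹ • (ρ * a0) := by
    rw [hρ, mul_sub, sub_mul, ← mul_assoc, ← mul_assoc, r02, r01, smul_sub, mul_assoc a1, ← r03]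
    simp only [smul_mul_assoc, mul_assoc]
  have e1 : a1 * ρ = q^2 • (ρ * a1) := by
    rw [hρ, mul_sub, sub_mul, ← mul_assoc, r12, mul_assoc a1 a3 a1, mul_assoc a2 a0 a1, r01, r13]
    simp only [smul_mul_assoc, mul_smul_comm, smul_smul, mul_assoc, smul_sub,
      mul_inv_cancel₀ hq2, one_smul]
  have e2 : a2 * ρ = q^2 • (ρ * a2) := by
    rw [hρ, mul_sub, sub_mul, mul_assoc a1 a3 a2, mul_assoc a2 a0 a2, r02, ← mul_assoc a2 a1 a3,
      ← r12, mul_assoc a1 a2 a3, r23]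
    simp only [smul_mul_assoc, mul_smul_comm, smul_smul, mul_assoc, smul_sub,
      mul_inv_cancel₀ hq2, one_smul]
  have e3 : a3 * ρ = (q^2)⁻¹ • (ρ * a3) := by
    rw [hρ, mul_sub, sub_mul, mul_assoc a2 a0 a3, r03, ← mul_assoc a2 a3 a0, r23,
      ← mul_assoc a3 a1 a3, r13]
    simp only [smul_mul_assoc, smul_smul, mul_assoc, smul_sub, inv_mul_cancel₀ hq2, one_smul]
  obtain ⟨ψ, hψ⟩ := gr_lift q (B := B)
    ![S, S * a3, -(S * a0), S * a2, -(S * a1), q⁻¹ • (S * ρ)]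
    (by
      change S * (S * a3) = (q^2)⁻¹ • (S * a3 * S)
      rw [mul_assoc S a3 S, d3, mul_smul_comm, smul_smul, inv_mul_cancel₀ hq2, one_smul])
    (by
      change S * -(S * a0) = (q^2)⁻¹ • (-(S * a0) * S)
      rw [neg_mul, mul_assoc S a0 S, d0, mul_smul_comm, smul_neg, smul_smul,
        inv_mul_cancel₀ hq2, one_smul, mul_neg])
    (by
      change S * (S * a2) = q^2 • (S * a2 * S)
      rw [mul_assoc S a2 S, d2, mul_smul_comm, smul_smul, mul_inv_cancel₀ hq2, one_smul])
    (by
      change S * -(S * a1) = q^2 • (-(S * a1) * S)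
      rw [neg_mul, mul_assoc S a1 S, d1, mul_smul_comm, smul_neg, smul_smul,
        mul_inv_cancel₀ hq2, one_smul, mul_neg])
    (by
      change S * a3 * (S * a2) = q^2 • (S * a2 * (S * a3))
      rw [prod_aux d3, prod_aux d2, r23]
      simp only [mul_smul_comm, smul_smul]
      congr 1; field_simp)
    (by
      change S * a3 * -(S * a1) = q^2 • (-(S * a1) * (S * a3))
      rw [mul_neg, neg_mul, prod_aux d3, prod_aux d1, r13]
      simp only [mul_smul_comm, smul_smul, smul_neg]
      congr 2; field_simp)
    (by
      change -(S * a0) * (S * a2) = q^2 • (S * a2 * -(S * a0))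
      rw [mul_neg, neg_mul, prod_aux d0, prod_aux d2, r02]
      simp only [mul_smul_comm, smul_smul, smul_neg])
    (by
      change -(S * a0) * -(S * a1) = q^2 • (-(S * a1) * -(S * a0))
      rw [neg_mul_neg, neg_mul_neg, prod_aux d0, prod_aux d1, r01]
      simp only [mul_smul_comm, smul_smul])
    (by
      intro i
      fin_cases i
      · change q⁻¹ • (S * ρ) * S = S * q⁻¹ • (S * ρ)
        rw [smul_mul_assoc, mul_assoc, dρ, one_smul, mul_smul_comm]
      · change q⁻¹ • (S * ρ) * (S * a3) = (S * a3) * q⁻¹ • (S * ρ)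
        rw [smul_mul_assoc, mul_smul_comm, prod_aux dρ, prod_aux d3, e3]
        simp only [mul_smul_comm, smul_smul]
        congr 1; field_simp
      · change q⁻¹ • (S * ρ) * -(S * a0) = -(S * a0) * q⁻¹ • (S * ρ)
        rw [mul_neg, neg_mul, smul_mul_assoc, mul_smul_comm, prod_aux dρ, prod_aux d0, e0]
        simp only [mul_smul_comm, smul_smul]
        congr 2; field_simp
      · change q⁻¹ • (S * ρ) * (S * a2) = (S * a2) * q⁻¹ • (S * ρ)
        rw [smul_mul_assoc, mul_smul_comm, prod_aux dρ, prod_aux d2, e2]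
        simp only [mul_smul_comm, smul_smul]
        congr 1; field_simp
      · change q⁻¹ • (S * ρ) * -(S * a1) = -(S * a1) * q⁻¹ • (S * ρ)
        rw [mul_neg, neg_mul, smul_mul_assoc, mul_smul_comm, prod_aux dρ, prod_aux d1, e1]
        simp only [mul_smul_comm, smul_smul]
        congr 2; field_simp
      · rfl)
    (by
      change S * a3 * -(S * a0) = -(S * a0) * (S * a3)
      rw [mul_neg, neg_mul, prod_aux d3, prod_aux d0, r03])
    (by
      change S * a2 * -(S * a1) = -(S * a1) * (S * a2)
      rw [mul_neg, neg_mul, prod_aux d2, prod_aux d1, r12])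
    (by
      change S * q⁻¹ • (S * ρ) = q⁻¹ • (S * a3 * -(S * a1)) - q • (S * a2 * -(S * a0))
      rw [mul_neg, mul_neg, prod_aux d3, prod_aux d2, hρ, r13]
      simp only [mul_smul_comm, smul_smul, smul_neg, mul_sub, smul_sub]
      rw [sub_neg_eq_add, neg_add_eq_sub]
      congr 2; field_simp)
  exact ⟨ψ, hψ 0, hψ 2, hψ 4, hψ 3, hψ 1⟩

/-- The key representation. -/
lemma key_rep (q : ℂ) (hq : q ≠ 0) : ∃ (B : Type) (_ : Ring B) (_ : Algebra ℂ B)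
    (L : R4tAlg q →ₐ[ℂ] B) (ψ : GrAlg q →ₐ[ℂ] B) (S : B),
    Function.Injective L ∧ IsUnit S ∧ ψ (Λm q 0) = S ∧
    ψ (Λm q 2) = - (S * L (xg q 0)) ∧ ψ (Λm q 4) = - (S * L (xg q 1)) ∧
    ψ (Λm q 3) = S * L (xg q 2) ∧ ψ (Λm q 1) = S * L (xg q 3) := by
  have hq2 : q ^ 2 ≠ 0 := pow_ne_zero 2 hq
  obtain ⟨σ, hσ⟩ := r4_scale q ![(q^2)⁻¹, q^2, q^2, (q^2)⁻¹]
  obtain ⟨τ, hτ⟩ := r4_scale q ![q^2, (q^2)⁻¹, (q^2)⁻¹, q^2]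
  have hστ : σ.comp τ = AlgHom.id ℂ _ := by
    apply r4_ext
    intro i
    simp only [AlgHom.comp_apply, hσ, hτ, map_smul, smul_smul, AlgHom.id_apply]
    fin_cases i <;> simp [hq]
  have hτσ : τ.comp σ = AlgHom.id ℂ _ := by
    apply r4_ext
    intro i
    simp only [AlgHom.comp_apply, hσ, hτ, map_smul, smul_smul, AlgHom.id_apply]
    fin_cases i <;> simp [hq]
  obtain ⟨S, hS⟩ : ∃ S : Module.End ℂ (R4tAlg q), S = σ.toLinearMap := ⟨_, rfl⟩
  obtain ⟨L, hL⟩ : ∃ L : R4tAlg q →ₐ[ℂ] Module.End ℂ (R4tAlg q),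
    L = Algebra.lmul ℂ (R4tAlg q) := ⟨_, rfl⟩
  have hinj : Function.Injective L := by
    intro x y hxy
    have h1 : ∀ z, L z 1 = z := by
      intro z
      rw [hL]
      exact mul_one z
    rw [← h1 x, hxy, h1]
  have hU : IsUnit S := by
    refine ⟨⟨S, τ.toLinearMap, ?_, ?_⟩, rfl⟩
    · ext x; rw [hS]; exact DFunLike.congr_fun hστ x
    · ext x; rw [hS]; exact DFunLike.congr_fun hτσ x
  have hSL : ∀ a, S * L a = L (σ a) * S := by
    intro a
    ext x
    rw [hS, hL]
    exact map_mul σ a x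
  obtain ⟨r02, r13, r01, r23, r03, r12⟩ := r4_rel q
  replace r02 := congrArg L r02
  replace r13 := congrArg L r13
  replace r01 := congrArg L r01
  replace r23 := congrArg L r23
  replace r03 := congrArg L r03
  replace r12 := congrArg L r12
  simp only [map_mul, map_smul] at r02 r13 r01 r23 r03 r12
  have c0 : S * L (xg q 0) = (q^2)⁻¹ • (L (xg q 0) * S) := by
    rw [hSL, hσ, map_smul, smul_mul_assoc]; rfl
  have c1 : S * L (xg q 1) = q^2 • (L (xg q 1) * S) := by
    rw [hSL, hσ, map_smul, smul_mul_assoc]; rfl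
  have c2 : S * L (xg q 2) = q^2 • (L (xg q 2) * S) := by
    rw [hSL, hσ, map_smul, smul_mul_assoc]; rfl
  have c3 : S * L (xg q 3) = (q^2)⁻¹ • (L (xg q 3) * S) := by
    rw [hSL, hσ, map_smul, smul_mul_assoc]; rfl
  obtain ⟨ψ, hψ⟩ := rep_gen q hq S _ _ _ _ c0 c1 c2 c3 r02 r13 r01 r23 r03 r12
  exact ⟨Module.End ℂ (R4tAlg q), inferInstance, inferInstance, L, ψ, S, hinj, hU, hψ⟩

/-- Localization of `A(Gr_θ(2;4))` at the non-central hermitean minor `Λ¹²`: `Λ¹²` is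
normal, i.e. `Λ¹²·A = A·Λ¹²` (hence its powers form a left Ore set); in any universal
localization `Loc` inverting `Λ¹²`, the elements `ζ₁ = −(Λ¹²)⁻¹Λ¹⁴, ζ₂ = −(Λ¹²)⁻¹Λ²⁴,
ζ̄₁ = (Λ¹²)⁻¹Λ²³, ζ̄₂ = (Λ¹²)⁻¹Λ¹³` satisfy the braided plane relations and
`q(Λ¹²)⁻¹Λ³⁴ = ζ̄₁ζ₁ − ζ₂ζ̄₂`; and the unital subalgebra they generate is isomorphic
to the presented algebra `A(ℝ̃⁴_θ)` via `x₁ ↦ ζ₁, x₂ ↦ ζ₂, y₁ ↦ ζ̄₁, y₂ ↦ ζ̄₂`. -/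
theorem grassmannian_localization_R4tilde (q : ℂ) (hq : q ≠ 0)
    (Loc : Type) [Ring Loc] [Algebra ℂ Loc] (φ : GrAlg q →ₐ[ℂ] Loc) (v : Loc)
    (hv : φ (Λm q 0) * v = 1) (hv' : v * φ (Λm q 0) = 1)
    (huniv : ∀ (B : Type) [Ring B] [Algebra ℂ B] (ψ : GrAlg q →ₐ[ℂ] B),
      IsUnit (ψ (Λm q 0)) → ∃! χ : Loc →ₐ[ℂ] B, χ.comp φ = ψ)
    (ζ₁ ζ₂ ζb₁ ζb₂ : Loc)
    (hζ₁ : ζ₁ = -(v * φ (Λm q 2))) (hζ₂ : ζ₂ = -(v * φ (Λm q 4)))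
    (hζb₁ : ζb₁ = v * φ (Λm q 3)) (hζb₂ : ζb₂ = v * φ (Λm q 1)) :
    (Set.range (fun a : GrAlg q => Λm q 0 * a)
        = Set.range (fun a : GrAlg q => a * Λm q 0)) ∧
      Nonempty (OreLocalization.OreSet (Submonoid.powers (Λm q 0))) ∧
      (ζ₁ * ζb₁ = (q ^ 2)⁻¹ • (ζb₁ * ζ₁) ∧ ζ₂ * ζb₂ = q ^ 2 • (ζb₂ * ζ₂) ∧
        ζ₁ * ζ₂ = (q ^ 2)⁻¹ • (ζ₂ * ζ₁) ∧ ζb₁ * ζb₂ = q ^ 2 • (ζb₂ * ζb₁) ∧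
        ζ₁ * ζb₂ = ζb₂ * ζ₁ ∧ ζ₂ * ζb₁ = ζb₁ * ζ₂ ∧
        q • (v * φ (Λm q 5)) = ζb₁ * ζ₁ - ζ₂ * ζb₂) ∧
      ∃ Φ : R4tAlg q →ₐ[ℂ] Loc, Function.Injective Φ ∧
        Φ (xg q 0) = ζ₁ ∧ Φ (xg q 1) = ζ₂ ∧ Φ (xg q 2) = ζb₁ ∧ Φ (xg q 3) = ζb₂ ∧
        Φ.range = Algebra.adjoin ℂ {ζ₁, ζ₂, ζb₁, ζb₂} := by
  refine ⟨gr_range q hq, gr_ore q hq, ?_⟩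
  have hq2 : q ^ 2 ≠ 0 := pow_ne_zero 2 hq
  have hrel : (ζ₁ * ζb₁ = (q ^ 2)⁻¹ • (ζb₁ * ζ₁) ∧ ζ₂ * ζb₂ = q ^ 2 • (ζb₂ * ζ₂) ∧
        ζ₁ * ζ₂ = (q ^ 2)⁻¹ • (ζ₂ * ζ₁) ∧ ζb₁ * ζb₂ = q ^ 2 • (ζb₂ * ζb₁) ∧
        ζ₁ * ζb₂ = ζb₂ * ζ₁ ∧ ζ₂ * ζb₁ = ζb₁ * ζ₂ ∧
        q • (v * φ (Λm q 5)) = ζb₁ * ζ₁ - ζ₂ * ζb₂) := by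
    obtain ⟨a, b, c, d, e, f, g, h, -, l, m, n⟩ := gr_rel q
    replace a := congrArg φ a
    replace b := congrArg φ b
    replace c := congrArg φ c
    replace d := congrArg φ d
    replace e := congrArg φ e
    replace f := congrArg φ f
    replace g := congrArg φ g
    replace h := congrArg φ h
    replace l := congrArg φ l
    replace m := congrArg φ m
    replace n := congrArg φ n
    simp only [map_mul, map_smul, map_sub] at a b c d e f g h l m n
    replace a := inv_comm_aux hv hv' a
    replace b := inv_comm_aux hv hv' b
    replace c := inv_comm_aux hv hv' c
    replace d := inv_comm_aux hv hv' d
    subst hζ₁ hζ₂ hζb₁ hζb₂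
    simp only [neg_mul, mul_neg, neg_neg, prod_aux a, prod_aux b, prod_aux c, prod_aux d,
      e, f, g, h, l, m, mul_smul_comm, smul_smul, smul_neg]
    refine ⟨?_, ?_, ?_, ?_, trivial, trivial, ?_⟩
    · trivial
    · congr 2; field_simp
    · trivial
    · congr 1; field_simp
    · have h5 : v * φ (Λm q 5) = v * (v * (φ (Λm q 0) * φ (Λm q 5))) := by
        rw [← mul_assoc v (φ (Λm q 0)), hv', one_mul]
      rw [h5, n, f]
      simp only [mul_sub, smul_sub, mul_smul_comm, smul_smul]
      rw [sub_neg_eq_add, neg_add_eq_sub]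
      congr 2 <;> field_simp
  refine ⟨hrel, ?_⟩
  obtain ⟨k1, k2, k3, k4, k5, k6, -⟩ := hrel
  obtain ⟨Φ, hΦ⟩ := r4_lift q ![ζ₁, ζ₂, ζb₁, ζb₂] k1 k2 k3 k4 k5 k6
  refine ⟨Φ, ?_, hΦ 0, hΦ 1, hΦ 2, hΦ 3, ?_⟩
  · obtain ⟨B, _, _, L, ψ, S, hinj, hU, p0, p2, p4, p3, p1⟩ := key_rep q hq
    obtain ⟨χ, hχ, -⟩ := huniv B ψ (by rw [p0]; exact hU)
    have hχ' : ∀ a, χ (φ a) = ψ a := fun a => DFunLike.congr_fun hχ a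
    have hvS : χ v * S = 1 := by rw [← p0, ← hχ', ← map_mul, hv', map_one]
    have hcomp : χ.comp Φ = L := by
      apply r4_ext
      intro i
      rw [AlgHom.comp_apply, hΦ]
      fin_cases i
      · change χ ζ₁ = _
        rw [hζ₁, map_neg, map_mul, hχ', p2, mul_neg, neg_neg, ← mul_assoc, hvS, one_mul]; rfl
      · change χ ζ₂ = _
        rw [hζ₂, map_neg, map_mul, hχ', p4, mul_neg, neg_neg, ← mul_assoc, hvS, one_mul]; rfl
      · change χ ζb₁ = _
        rw [hζb₁, map_mul, hχ', p3, ← mul_assoc, hvS, one_mul]; rfl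
      · change χ ζb₂ = _
        rw [hζb₂, map_mul, hχ', p1, ← mul_assoc, hvS, one_mul]; rfl
    intro x y hxy
    apply hinj
    rw [← hcomp, AlgHom.comp_apply, AlgHom.comp_apply, hxy]
  · apply le_antisymm
    · rintro _ ⟨x, rfl⟩
      obtain ⟨y, rfl⟩ := RingQuot.mkAlgHom_surjective ℂ (R4tRel q) x
      change Φ _ ∈ _
      induction y using FreeAlgebra.induction with
      | grade0 r =>
        rw [AlgHom.commutes, AlgHom.commutes]
        exact Subalgebra.algebraMap_mem _ r
      | grade1 i =>
        change Φ (xg q i) ∈ _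
        rw [hΦ]
        apply Algebra.subset_adjoin
        fin_cases i <;> simp
      | mul x y hx hy => rw [map_mul, map_mul]; exact mul_mem hx hy
      | add x y hx hy => rw [map_add, map_add]; exact add_mem hx hy
    · rw [Algebra.adjoin_le_iff]
      rintro x (rfl | rfl | rfl | rfl)
      · exact ⟨_, hΦ 0⟩
      · exact ⟨_, hΦ 1⟩
      · exact ⟨_, hΦ 2⟩
      · exact ⟨_, hΦ 3⟩
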